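/- arXiv:1103.5686 — 7 statements merged into one kernel-verified Lean document; each statement's English description precedes it below -/
import Mathlib

section
/- Ramsey theorem for the class of all finite permutations: for all natural numbers a, b, r ≥ 1 and all permutations A : Equiv.Perm (Fin a) and B : Equiv.Perm (Fin b), there exist a natural number c and a permutation C : Equiv.Perm (Fin c) such that for every coloring χ of the embeddings of A into C with r colors, there is an embedding g of B into C such that χ (g ∘ e) takes the same value for all embeddings e of A into B. -/
/-- An embedding of the permutation `α` (as the structure `(Fin a, <, <_α)`)
into the permutation `γ` (as the structure `(Fin c, <, <_γ)`):
a strictly monotone map preserving and reflecting the second order. -/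
def PermEmbedding {a c : ℕ} (α : Equiv.Perm (Fin a)) (γ : Equiv.Perm (Fin c))
    (f : Fin a → Fin c) : Prop :=
  StrictMono f ∧ ∀ i j : Fin a, α i < α j ↔ γ (f i) < γ (f j)

/-- If the finite Ramsey theorem holds for `k`-tuples, then every coloring of increasing
`(k + 1)`-tuples of a large enough set is, on some subset of size `m`, determined by the
first entry of the tuple. -/
theorem exists_finset_color_eq_of_head {K : Type} [Nonempty K] {k : ℕ}
    (ramsey : ∀ b : ℕ, ∃ N : ℕ, ∀ (α : Type) [LinearOrder α] (S : Finset α), N ≤ S.card →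
      ∀ χ : (Fin k → α) → K, ∃ T ⊆ S, b ≤ T.card ∧
        ∃ c, ∀ f : Fin k → α, StrictMono f → (∀ i, f i ∈ T) → χ f = c) (m : ℕ) :
    ∃ N : ℕ, ∀ (α : Type) [LinearOrder α] (S : Finset α), N ≤ S.card →
      ∀ χ : (Fin (k + 1) → α) → K, ∃ T ⊆ S, m ≤ T.card ∧
        ∃ col : α → K, ∀ f : Fin (k + 1) → α, StrictMono f → (∀ i, f i ∈ T) →
          χ f = col (f 0) := by
  induction m with
  | zero =>
    refine ⟨0, fun α _ S _ χ => ⟨∅, by simp, by simp, fun _ => Classical.arbitrary K, ?_⟩⟩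
    intro f _ hT
    exact absurd (hT 0) (by simp)
  | succ m ih =>
    obtain ⟨M, hM⟩ := ih
    obtain ⟨N, hN⟩ := ramsey M
    refine ⟨N + 1, fun α _ S hS χ => ?_⟩
    have hne : S.Nonempty := Finset.card_pos.mp (by omega)
    set x := S.min' hne
    have hxS : x ∈ S := S.min'_mem hne
    have hcard : N ≤ (S.erase x).card := by rw [Finset.card_erase_of_mem hxS]; omega
    obtain ⟨T', hT'S, hT'card, c, hc⟩ := hN α (S.erase x) hcard (fun f => χ (Fin.cons x f))
    obtain ⟨T, hTT', hTcard, col, hcol⟩ := hM α T' hT'card χ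
    have hlt : ∀ y ∈ T, x < y := fun y hy =>
      S.min'_lt_of_mem_erase_min' hne (hT'S (hTT' hy))
    have hxT : x ∉ T := fun h => lt_irrefl _ (hlt x h)
    refine ⟨insert x T, ?_, ?_, Function.update col x c, ?_⟩
    · intro y hy
      rcases Finset.mem_insert.mp hy with rfl | hy
      · exact hxS
      · exact Finset.mem_of_mem_erase (hT'S (hTT' hy))
    · rw [Finset.card_insert_of_notMem hxT]; omega
    · intro f hf hfT
      have hx_le : ∀ i, x ≤ f i := fun i => by
        rcases Finset.mem_insert.mp (hfT i) with h | h
        · exact h.ge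
        · exact (hlt _ h).le
      by_cases h0 : f 0 = x
      · rw [h0, Function.update_self]
        have htail := hc (Fin.tail f) (fun i j hij => hf (Fin.succ_lt_succ_iff.mpr hij))
          (fun i => ?_)
        · rwa [← h0, Fin.cons_self_tail] at htail
        · have hi : x < f i.succ := h0 ▸ hf (Fin.succ_pos i)
          exact hTT' ((Finset.mem_insert.mp (hfT i.succ)).resolve_left hi.ne')
      · rw [Function.update_of_ne h0]
        refine hcol f hf fun i => (Finset.mem_insert.mp (hfT i)).resolve_left ?_
        exact (((hx_le 0).lt_of_ne' h0).trans_le (hf.monotone (Fin.zero_le i))).ne'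

/-- The finite Ramsey theorem for increasing `k`-tuples in finite subsets of linear orders. -/
theorem exists_finset_monochromatic_strictMono {K : Type} [Finite K] [Nonempty K] (k b : ℕ) :
    ∃ N : ℕ, ∀ (α : Type) [LinearOrder α] (S : Finset α), N ≤ S.card →
      ∀ χ : (Fin k → α) → K, ∃ T ⊆ S, b ≤ T.card ∧
        ∃ c, ∀ f : Fin k → α, StrictMono f → (∀ i, f i ∈ T) → χ f = c := by
  classical
  have := Fintype.ofFinite K
  induction k generalizing b with
  | zero =>
    refine ⟨b, fun α _ S hS χ => ⟨S, subset_rfl, hS, χ Fin.elim0, fun f _ _ => ?_⟩⟩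
    exact congrArg χ (Subsingleton.elim _ _)
  | succ k ih =>
    obtain ⟨N, hN⟩ := exists_finset_color_eq_of_head ih (Fintype.card K * b + 1)
    refine ⟨N, fun α _ S hS χ => ?_⟩
    obtain ⟨T, hTS, hT, col, hcol⟩ := hN α S hS χ
    obtain ⟨c, -, hc⟩ := Finset.exists_lt_card_fiber_of_mul_lt_card_of_maps_to
      (s := T) (t := Finset.univ) (f := col) (n := b) (fun _ _ => Finset.mem_univ _)
      (by rw [Finset.card_univ]; omega)
    refine ⟨T.filter (col · = c), (Finset.filter_subset _ _).trans hTS, hc.le, c, ?_⟩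
    intro f hf hfT
    rw [hcol f hf fun i => (Finset.mem_filter.mp (hfT i)).1]
    exact (Finset.mem_filter.mp (hfT 0)).2

/-- The finite Ramsey theorem for strictly monotone maps between finite ordinals. -/
theorem exists_monochromatic_strictMono (K : Type) [Finite K] [Nonempty K] (k b : ℕ) :
    ∃ N : ℕ, ∀ χ : (Fin k → Fin N) → K, ∃ g : Fin b → Fin N, StrictMono g ∧
      ∃ c, ∀ e : Fin k → Fin b, StrictMono e → χ (g ∘ e) = c := by
  obtain ⟨N, hN⟩ := exists_finset_monochromatic_strictMono (K := K) k b
  refine ⟨N, fun χ => ?_⟩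
  obtain ⟨T, -, hT, c, hc⟩ := hN (Fin N) Finset.univ (by simp) χ
  have hg := (T.orderEmbOfCardLe hT).strictMono
  exact ⟨_, hg, c, fun e he => hc _ (hg.comp he) fun i => T.orderEmbOfCardLe_mem hT (e i)⟩

/-- The product Ramsey theorem for pairs of strictly monotone maps. -/
theorem exists_monochromatic_strictMono_prod (K : Type) [Finite K] [Nonempty K] (k b : ℕ) :
    ∃ M N : ℕ, ∀ χ : (Fin k → Fin M) → (Fin k → Fin N) → K,
      ∃ (g : Fin b → Fin M) (h : Fin b → Fin N), StrictMono g ∧ StrictMono h ∧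
        ∃ c, ∀ d e : Fin k → Fin b, StrictMono d → StrictMono e → χ (g ∘ d) (h ∘ e) = c := by
  obtain ⟨N, hN⟩ := exists_monochromatic_strictMono K k b
  obtain ⟨M, hM⟩ := exists_monochromatic_strictMono ((Fin k → Fin N) → K) k b
  refine ⟨M, N, fun χ => ?_⟩
  obtain ⟨g, hg, χ', hχ'⟩ := hM χ
  obtain ⟨h, hh, c, hc⟩ := hN χ'
  exact ⟨g, h, hg, hh, c, fun d e hd he => by rw [hχ' d hd, hc e he]⟩

theorem finProdFinEquiv_lt_of_fst_lt {m n : ℕ} {x x' : Fin m} (y y' : Fin n) (h : x < x') :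
    finProdFinEquiv (x, y) < finProdFinEquiv (x', y') := by
  rw [Fin.lt_def, finProdFinEquiv_apply_val, finProdFinEquiv_apply_val]
  have h' : (x : ℕ) + 1 ≤ x' := h
  have hmul := Nat.mul_le_mul_left n h'
  have hy := y.isLt
  rw [Nat.mul_add] at hmul
  dsimp only
  omega

/-- The permutation on the `m × n` grid whose first order compares the coordinates
lexicographically and whose second order compares the swapped coordinates lexicographically. -/
def gridPerm (m n : ℕ) : Equiv.Perm (Fin (m * n)) :=
  (finProdFinEquiv.symm.trans ((Equiv.prodComm _ _).trans finProdFinEquiv)).trans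
    (finCongr (Nat.mul_comm n m))

theorem gridPerm_lt_of_snd_lt {m n : ℕ} (x x' : Fin m) {y y' : Fin n} (h : y < y') :
    gridPerm m n (finProdFinEquiv (x, y)) < gridPerm m n (finProdFinEquiv (x', y')) := by
  simpa [gridPerm, Fin.lt_def] using finProdFinEquiv_lt_of_fst_lt x x' h

theorem permEmbedding_gridPerm {b m n : ℕ} (B : Equiv.Perm (Fin b)) {g : Fin b → Fin m}
    {h : Fin b → Fin n} (hg : StrictMono g) (hh : StrictMono h) :
    PermEmbedding B (gridPerm m n) fun i => finProdFinEquiv (g i, h (B i)) := by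
  refine ⟨fun i j hij => finProdFinEquiv_lt_of_fst_lt _ _ (hg hij), fun i j => ?_⟩
  have hmono : StrictMono fun i =>
      gridPerm m n (finProdFinEquiv (g (B.symm i), h i)) :=
    fun i j hij => gridPerm_lt_of_snd_lt _ _ (hh hij)
  simpa using (hmono.lt_iff_lt (a := B i) (b := B j)).symm

theorem PermEmbedding.strictMono_conj {a c : ℕ} {α : Equiv.Perm (Fin a)}
    {γ : Equiv.Perm (Fin c)} {f : Fin a → Fin c} (hf : PermEmbedding α γ f) :
    StrictMono (γ ∘ f ∘ α.symm) :=
  fun i j hij => (hf.2 _ _).mp (by simpa using hij)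

/-- Ramsey theorem for the class of all finite permutations. -/
theorem ramsey_all_permutations (a b r : ℕ) (ha : 1 ≤ a) (hb : 1 ≤ b) (hr : 1 ≤ r)
    (A : Equiv.Perm (Fin a)) (B : Equiv.Perm (Fin b)) :
    ∃ (c : ℕ) (C : Equiv.Perm (Fin c)),
      ∀ χ : (Fin a → Fin c) → Fin r,
        ∃ g : Fin b → Fin c, PermEmbedding B C g ∧
          ∃ k : Fin r, ∀ e : Fin a → Fin b, PermEmbedding A B e → χ (g ∘ e) = k := by
  have : Nonempty (Fin r) := ⟨⟨0, hr⟩⟩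
  obtain ⟨M, N, hMN⟩ := exists_monochromatic_strictMono_prod (Fin r) a b
  refine ⟨M * N, gridPerm M N, fun χ => ?_⟩
  obtain ⟨g, h, hg, hh, k, hk⟩ := hMN fun u v => χ fun i => finProdFinEquiv (u i, v (A i))
  refine ⟨_, permEmbedding_gridPerm B hg hh, k, fun e he => ?_⟩
  rw [← hk e _ he.1 he.strictMono_conj]
  congr 1
  ext i
  simp
end

section
/- The class of reversals is a Ramsey class: for all natural numbers a, b, r ≥ 1 there exists a natural number c such that for every coloring χ of the embeddings of the reversal permutation on Fin a into the reversal permutation on Fin c with r colors, there is an embedding g of the reversal permutation on Fin b into the reversal permutation on Fin c such that χ (g ∘ e) takes the same value for all embeddings e of the reversal on Fin a into the reversal on Fin b. -/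
/-- Every strictly monotone map embeds a reversal into a reversal. -/
theorem StrictMono.permEmbedding_revPerm {a c : ℕ} {f : Fin a → Fin c} (hf : StrictMono f) :
    PermEmbedding Fin.revPerm Fin.revPerm f :=
  ⟨hf, fun i j => by simp [Fin.rev_lt_rev, hf.lt_iff_lt]⟩

/-- The finite Ramsey theorem for colorings of `a`-element sets: every sufficiently large finite
set has an `m`-element subset all of whose `a`-element subsets receive the same color. -/
theorem Finset.exists_monochromatic_powersetCard (α : Type*) [LinearOrder α] (κ : Type*)
    [Fintype κ] (a m : ℕ) :
    ∃ N : ℕ, ∀ S : Finset α, N ≤ S.card → ∀ χ : Finset α → κ,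
      ∃ T ⊆ S, T.card = m ∧ ∃ k, ∀ U ⊆ T, U.card = a → χ U = k := by
  classical
  induction a generalizing m with
  | zero =>
    refine ⟨m, fun S hS χ => ?_⟩
    obtain ⟨T, hTS, hT⟩ := Finset.exists_subset_card_eq hS
    exact ⟨T, hTS, hT, χ ∅, fun U _ hU => by rw [Finset.card_eq_zero.mp hU]⟩
  | succ a ih =>
    have min_determined (n : ℕ) : ∃ N : ℕ, ∀ S : Finset α, N ≤ S.card → ∀ χ : Finset α → κ,
        ∃ T ⊆ S, T.card = n ∧ ∃ f : α → κ, ∀ x ∈ T, ∀ U ⊆ T, U.card = a →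
          (∀ y ∈ U, x < y) → χ (insert x U) = f x := by
      induction n with
      | zero =>
        exact ⟨0, fun S _ χ => ⟨∅, Finset.empty_subset S, rfl, fun _ => χ ∅, by simp⟩⟩
      | succ n ihn =>
        obtain ⟨M, hM⟩ := ihn
        obtain ⟨N, hN⟩ := ih M
        refine ⟨N + 1, fun S hS χ => ?_⟩
        have hne : S.Nonempty := Finset.card_pos.mp (by omega)
        set x := S.min' hne
        have hxS : x ∈ S := S.min'_mem hne
        obtain ⟨T, hTS, hT, k, hk⟩ := hN (S.erase x)
          (by rw [Finset.card_erase_of_mem hxS]; omega) (fun U => χ (insert x U))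
        obtain ⟨T', hTT, hT', f, hf⟩ := hM T hT.ge χ
        have lt_of_mem : ∀ y ∈ T', x < y := fun y hy =>
          S.min'_lt_of_mem_erase_min' hne (hTS (hTT hy))
        have hxT : x ∉ T' := fun h => (lt_of_mem x h).false
        refine ⟨insert x T', Finset.insert_subset hxS
          ((hTT.trans hTS).trans (Finset.erase_subset _ _)), by
            rw [Finset.card_insert_of_notMem hxT, hT'], Function.update f x k, ?_⟩
        intro z hz U hU hUa hzU
        have hxU : x ∉ U := by
          intro h
          rcases Finset.mem_insert.mp hz with rfl | hz
          · exact (hzU _ h).false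
          · exact (hzU _ h).not_gt (lt_of_mem z hz)
        have hUT : U ⊆ T' := (Finset.subset_insert_iff_of_notMem hxU).mp hU
        rcases Finset.mem_insert.mp hz with rfl | hz
        · rw [Function.update_self]
          exact hk U (hUT.trans hTT) hUa
        · rw [Function.update_of_ne (lt_of_mem z hz).ne']
          exact hf z hz U hUT hUa hzU
    obtain ⟨N, hN⟩ := min_determined (Fintype.card κ * m)
    refine ⟨N, fun S hS χ => ?_⟩
    obtain ⟨T, hTS, hT, f, hf⟩ := hN S hS χ
    obtain ⟨k, -, hk⟩ := Finset.exists_le_card_fiber_of_mul_le_card_of_maps_to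
      (s := T) (t := Finset.univ) (f := f) (n := m) (fun _ _ => Finset.mem_univ _)
      ⟨χ ∅, Finset.mem_univ _⟩ (by rw [hT, Finset.card_univ])
    obtain ⟨T', hTT, hT'⟩ := Finset.exists_subset_card_eq hk
    have hT'T : T' ⊆ T := hTT.trans (Finset.filter_subset _ _)
    refine ⟨T', hT'T.trans hTS, hT', k, fun U hU hUa => ?_⟩
    have hne : U.Nonempty := Finset.card_pos.mp (by omega)
    have hmem := U.min'_mem hne
    have := hf (U.min' hne) (hT'T (hU hmem)) (U.erase (U.min' hne))
      ((Finset.erase_subset _ _).trans (hU.trans hT'T))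
      (by rw [Finset.card_erase_of_mem hmem]; omega)
      (fun y hy => U.min'_lt_of_mem_erase_min' hne hy)
    rw [Finset.insert_erase hmem] at this
    rw [this]
    exact (Finset.mem_filter.mp (hTT (hU hmem))).2

/-- The class of reversals is a Ramsey class.  The reversal permutation on
`Fin n` is the order-reversing permutation `Fin.revPerm`, i.e. `i ↦ n - 1 - i`. -/
theorem ramsey_reversal_permutations (a b r : ℕ) (ha : 1 ≤ a) (hb : 1 ≤ b) (hr : 1 ≤ r) :
    ∃ c : ℕ,
      ∀ χ : (Fin a → Fin c) → Fin r,
        ∃ g : Fin b → Fin c,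
          PermEmbedding (Fin.revPerm : Equiv.Perm (Fin b)) (Fin.revPerm : Equiv.Perm (Fin c)) g ∧
          ∃ k : Fin r, ∀ e : Fin a → Fin b,
            PermEmbedding (Fin.revPerm : Equiv.Perm (Fin a)) (Fin.revPerm : Equiv.Perm (Fin b)) e →
              χ (g ∘ e) = k := by
  obtain ⟨c, hc⟩ := Finset.exists_monochromatic_powersetCard ℕ (Fin r) a b
  refine ⟨c, fun χ => ?_⟩
  let ψ (U : Finset ℕ) : Fin r :=
    if h : ∃ f : Fin a → Fin c, StrictMono f ∧ Finset.univ.image (fun i => (f i : ℕ)) = U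
    then χ h.choose else ⟨0, hr⟩
  have hψ (f : Fin a → Fin c) (hf : StrictMono f) :
      ψ (Finset.univ.image fun i => (f i : ℕ)) = χ f := by
    have h : ∃ f' : Fin a → Fin c, StrictMono f' ∧
      Finset.univ.image (fun i => (f' i : ℕ)) = Finset.univ.image (fun i => (f i : ℕ)) :=
      ⟨f, hf, rfl⟩
    have heq : h.choose = f := by
      refine (h.choose_spec.1.range_inj hf).mp (Fin.val_injective.image_injective ?_)
      simpa [← Set.range_comp, Function.comp_def] using
        congrArg (fun s : Finset ℕ => (s : Set ℕ)) h.choose_spec.2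
    simp only [ψ, dif_pos h, heq]
  obtain ⟨T, hT, hTb, k, hk⟩ := hc (Finset.range c) (Finset.card_range c).ge ψ
  let g (i : Fin b) : Fin c :=
    ⟨T.orderEmbOfFin hTb i, Finset.mem_range.mp (hT (T.orderEmbOfFin_mem hTb i))⟩
  have hg : StrictMono g := fun i j hij => (T.orderEmbOfFin hTb).strictMono hij
  refine ⟨g, hg.permEmbedding_revPerm, k, fun e he => ?_⟩
  have hge : StrictMono (g ∘ e) := hg.comp he.1
  rw [← hψ _ hge]
  refine hk _ (Finset.image_subset_iff.mpr fun i _ => T.orderEmbOfFin_mem hTb (e i)) ?_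
  exact (Finset.card_image_of_injective _ (Fin.val_injective.comp hge.injective)).trans
    (Finset.card_fin a)
end

section
/- Modified product Ramsey theorem for grids with unequal column heights: for all natural numbers r ≥ 1, tA ≥ 1, tB, all a : Fin tA → ℕ, and all b : ℕ, there exist natural numbers tC and c such that the following holds. For every coloring χ assigning an element of Fin r to each pair (g, S), where g : Fin tA → Fin tC is strictly monotone and S : Fin tA → Finset (Fin c) satisfies (S i).card = a i for all i, there exist a strictly monotone map h : Fin tB → Fin tC, sets Y : Fin tB → Finset (Fin c) with (Y j).card = b for all j, and a color k : Fin r, such that for every strictly monotone g' : Fin tA → Fin tB and every S : Fin tA → Finset (Fin c) with S i ⊆ Y (g' i) and (S i).card = a i for all i, we have χ (h ∘ g', S) = k. -/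
/-- Inductive step towards Ramsey's theorem: if colourings of the sets of size less than `n` can be
made to depend only on the size, then one finds large sets on which the colour of `insert x S`,
for `S` above `x` of size less than `n`, depends only on `x` and the size of `S`. -/
theorem exists_subset_color_insert_eq (κ : Type) (n : ℕ)
    (ramsey : ∀ m : ℕ, ∃ N : ℕ, ∀ (α : Type) [LinearOrder α] (X : Finset α) (f : Finset α → κ),
      N ≤ X.card → ∃ Y ⊆ X, Y.card = m ∧
        ∃ col : ℕ → κ, ∀ S ⊆ Y, S.card < n → f S = col S.card)
    (m : ℕ) :
    ∃ N : ℕ, ∀ (α : Type) [LinearOrder α] (X : Finset α) (f : Finset α → κ),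
      N ≤ X.card → ∃ Y ⊆ X, Y.card = m ∧
        ∃ col : α → ℕ → κ, ∀ x ∈ Y, ∀ S ⊆ Y, (∀ y ∈ S, x < y) → S.card < n →
          f (insert x S) = col x S.card := by
  induction m with
  | zero =>
    refine ⟨0, fun α _ X f _ => ⟨∅, by simp, rfl, fun _ _ => f ∅, by simp⟩⟩
  | succ m ih =>
    obtain ⟨N, hN⟩ := ih
    obtain ⟨M, hM⟩ := ramsey N
    refine ⟨M + 1, fun α _ X f hX => ?_⟩
    have hne : X.Nonempty := Finset.card_pos.mp (by omega)
    obtain ⟨Y, hYX, hYc, c, hc⟩ := hM α (X.erase (X.min' hne)) (fun S => f (insert (X.min' hne) S))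
      (by rw [Finset.card_erase_of_mem (X.min'_mem hne)]; omega)
    obtain ⟨Z, hZY, hZc, d, hd⟩ := hN α Y f hYc.ge
    set x₀ := X.min' hne with hx₀
    have hlt : ∀ z ∈ Z, x₀ < z := fun z hz => X.min'_lt_of_mem_erase_min' hne (hYX (hZY hz))
    have hx₀Z : x₀ ∉ Z := fun h => (hlt _ h).false
    refine ⟨insert x₀ Z, ?_, by rw [Finset.card_insert_of_notMem hx₀Z, hZc],
      Function.update d x₀ c, ?_⟩
    · exact Finset.insert_subset (X.min'_mem hne)
        ((hZY.trans hYX).trans (Finset.erase_subset _ _))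
    · intro x hx S hS hxS hSn
      have hx₀x : x₀ ≤ x := by
        rcases Finset.mem_insert.mp hx with rfl | h
        exacts [le_rfl, (hlt _ h).le]
      have hSZ : S ⊆ Z := fun y hy =>
        (Finset.mem_insert.mp (hS hy)).resolve_left (hx₀x.trans_lt (hxS y hy)).ne'
      rcases Finset.mem_insert.mp hx with rfl | h
      · rw [Function.update_self]
        exact hc S (hSZ.trans hZY) hSn
      · rw [Function.update_of_ne (hlt _ h).ne']
        exact hd x h S hSZ hxS hSn

/-- Finite Ramsey theorem, for all sizes less than `n` at once. -/
theorem exists_subset_color_eq_of_card_lt (κ : Type) [Finite κ] (n m : ℕ) :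
    ∃ N : ℕ, ∀ (α : Type) [LinearOrder α] (X : Finset α) (f : Finset α → κ),
      N ≤ X.card → ∃ Y ⊆ X, Y.card = m ∧
        ∃ col : ℕ → κ, ∀ S ⊆ Y, S.card < n → f S = col S.card := by
  classical
  induction n generalizing m with
  | zero =>
    refine ⟨m, fun α _ X f hX => ?_⟩
    obtain ⟨Y, hY, hYc⟩ := Finset.exists_subset_card_eq hX
    exact ⟨Y, hY, hYc, fun _ => f ∅, by simp⟩
  | succ n ih =>
    cases nonempty_fintype κ
    obtain ⟨N, hN⟩ := exists_subset_color_insert_eq κ n ih (Fintype.card (Fin n → κ) * m)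
    refine ⟨N, fun α _ X f hX => ?_⟩
    obtain ⟨Y, hYX, hYc, c, hc⟩ := hN α X f hX
    obtain ⟨d, -, hd⟩ := Finset.exists_le_card_fiber_of_mul_le_card_of_maps_to
      (s := Y) (t := (Finset.univ : Finset (Fin n → κ))) (f := fun x k => c x k) (n := m)
      (fun _ _ => Finset.mem_univ _) ⟨fun _ => f ∅, Finset.mem_univ _⟩
      (by rw [hYc, Finset.card_univ])
    obtain ⟨Z, hZ, hZc⟩ := Finset.exists_subset_card_eq hd
    refine ⟨Z, fun z hz => hYX (Finset.mem_filter.mp (hZ hz)).1, hZc,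
      fun k => if h : k - 1 < n ∧ k ≠ 0 then d ⟨k - 1, h.1⟩ else f ∅, fun S hS hSn => ?_⟩
    rcases S.eq_empty_or_nonempty with rfl | hne
    · simp
    have hpos : 0 < S.card := hne.card_pos
    have hmem := Finset.mem_filter.mp (hZ (hS (S.min'_mem hne)))
    have hcard := Finset.card_erase_of_mem (S.min'_mem hne)
    have key := hc (S.min' hne) hmem.1 (S.erase (S.min' hne))
      (fun y hy => (Finset.mem_filter.mp (hZ (hS (Finset.mem_of_mem_erase hy)))).1)
      (fun y hy => S.min'_lt_of_mem_erase_min' hne hy) (by omega)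
    rw [Finset.insert_erase (S.min'_mem hne), hcard] at key
    have hlt : S.card - 1 < n ∧ S.card ≠ 0 := by omega
    rw [key]
    beta_reduce
    rw [dif_pos hlt, ← hmem.2]

/-- Finite Ramsey theorem, for subsets of all sizes at once. -/
theorem exists_subset_color_eq_of_card (κ : Type) [Finite κ] (m : ℕ) :
    ∃ N : ℕ, ∀ (α : Type) [LinearOrder α] (X : Finset α) (f : Finset α → κ),
      N ≤ X.card → ∃ Y ⊆ X, Y.card = m ∧ ∃ col : ℕ → κ, ∀ S ⊆ Y, f S = col S.card := by
  obtain ⟨N, hN⟩ := exists_subset_color_eq_of_card_lt κ (m + 1) m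
  refine ⟨N, fun α _ X f hX => ?_⟩
  obtain ⟨Y, hYX, hYc, c, hc⟩ := hN α X f hX
  exact ⟨Y, hYX, hYc, c, fun S hS => hc S hS
    (Nat.lt_succ_of_le ((Finset.card_le_card hS).trans_eq hYc))⟩

/-- Product Ramsey theorem: the colour of a tuple of finite sets can be made to depend only on the
tuple of their sizes. -/
theorem exists_pi_subset_color_eq_of_card (t m : ℕ) (κ : Type) [Finite κ] :
    ∃ N : ℕ, ∀ f : (Fin t → Finset ℕ) → κ, ∃ Y : Fin t → Finset ℕ,
      (∀ i, Y i ⊆ Finset.range N) ∧ (∀ i, (Y i).card = m) ∧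
        ∃ col : (Fin t → ℕ) → κ, ∀ S : Fin t → Finset ℕ, (∀ i, S i ⊆ Y i) →
          f S = col fun i => (S i).card := by
  induction t generalizing κ with
  | zero =>
    exact ⟨0, fun f => ⟨Fin.elim0, fun i => i.elim0, fun i => i.elim0, fun _ => f Fin.elim0,
      fun S _ => congrArg f (Subsingleton.elim _ _)⟩⟩
  | succ t ih =>
    obtain ⟨M, hM⟩ := exists_subset_color_eq_of_card ((Fin t → Fin (m + 1)) → κ) m
    obtain ⟨N, hN⟩ := ih ((Finset.range M).powerset → κ)
    refine ⟨max M N, fun f => ?_⟩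
    obtain ⟨Y, hYN, hYc, c, hc⟩ := hN fun S P => f (Fin.cons P.1 S)
    obtain ⟨Z, hZM, hZc, d, hd⟩ := hM ℕ (Finset.range M)
      (fun P q => c (fun i => q i)
        ⟨P ∩ Finset.range M, Finset.mem_powerset.mpr Finset.inter_subset_right⟩)
      (Finset.card_range M).ge
    refine ⟨Fin.cons Z Y, ?_, ?_, fun q => d (q 0) fun i => Fin.ofNat (m + 1) (q i.succ), ?_⟩
    · refine Fin.cases ?_ fun i => ?_
      · exact hZM.trans (Finset.range_mono (le_max_left _ _))
      · exact (hYN i).trans (Finset.range_mono (le_max_right _ _))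
    · exact Fin.cases hZc hYc
    · intro S hS
      have hS₀ : S 0 ⊆ Z := hS 0
      have hS₁ : ∀ i : Fin t, S i.succ ⊆ Y i := fun i => hS i.succ
      have hmod : ∀ i : Fin t, (S i.succ).card % (m + 1) = (S i.succ).card := fun i =>
        Nat.mod_eq_of_lt (Nat.lt_succ_of_le ((Finset.card_le_card (hS₁ i)).trans_eq (hYc i)))
      have hhead := hd (S 0) hS₀
      have htail := congrFun (hc (Fin.tail S) hS₁)
        ⟨S 0, Finset.mem_powerset.mpr (hS₀.trans hZM)⟩
      simp only [Fin.cons_self_tail] at htail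
      rw [htail]
      beta_reduce
      rw [← hhead]
      simp only [Fin.ofNat, hmod, Finset.inter_eq_left.mpr (hS₀.trans hZM), Fin.tail]


/-- Modified product Ramsey theorem for grids with unequal column heights.
A copy of the grid `A` inside the grid `Fin c × Fin tC` is a pair `(g, S)` of a
strictly monotone choice `g` of `tA` columns together with an `(a i)`-element
subset `S i` of the `i`-th chosen column; a copy of `B` is a strictly monotone
choice `h` of `tB` columns together with `b`-element row sets `Y j`.  All copies
of `A` inside the found copy of `B` receive the same colour. -/
theorem modified_product_ramsey (r tA tB : ℕ) (hr : 1 ≤ r) (htA : 1 ≤ tA)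
    (a : Fin tA → ℕ) (b : ℕ) :
    ∃ tC c : ℕ,
      ∀ χ : (Fin tA → Fin tC) × (Fin tA → Finset (Fin c)) → Fin r,
        ∃ (h : Fin tB → Fin tC) (Y : Fin tB → Finset (Fin c)) (k : Fin r),
          StrictMono h ∧ (∀ j, (Y j).card = b) ∧
          ∀ (g' : Fin tA → Fin tB) (S : Fin tA → Finset (Fin c)),
            StrictMono g' → (∀ i, S i ⊆ Y (g' i)) → (∀ i, (S i).card = a i) →
              χ (h ∘ g', S) = k := by
  classical
  obtain ⟨tC, htC⟩ := exists_subset_color_eq_of_card (Fin r) tB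
  obtain ⟨c, hc⟩ := exists_pi_subset_color_eq_of_card tC b ((Fin tA → Fin tC) → Fin r)
  refine ⟨tC, c, fun χ => ?_⟩
  obtain ⟨Y, hYc, hYb, col, hcol⟩ := hc fun S g => χ (g, fun i => {x : Fin c | (x : ℕ) ∈ S (g i)})
  have hlt : ∀ j, ∀ x ∈ Y j, x < c := fun j x hx => Finset.mem_range.mp (hYc j hx)
  let colg : (Fin tA → Fin tC) → Fin r := fun g => col (Function.extend g a 0) g
  have hcolg : ∀ (g : Fin tA → Fin tC) (S : Fin tA → Finset (Fin c)), StrictMono g →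
      (∀ i, S i ⊆ (Y (g i)).attachFin (hlt _)) → (∀ i, (S i).card = a i) → χ (g, S) = colg g := by
    intro g S hg hS ha
    have hT := congrFun (hcol (Function.extend g (fun i => (S i).map Fin.valEmbedding) fun _ => ∅)
      (fun j => ?_)) g
    · simp only [hg.injective.extend_apply] at hT
      have hfin :
          (fun i => ({x : Fin c | (x : ℕ) ∈ (S i).map Fin.valEmbedding} : Finset (Fin c))) = S := by
        ext i x
        simp [Fin.val_inj]
      rw [hfin] at hT
      rw [hT]
      refine congrFun (congrArg col (funext fun j => ?_)) g
      by_cases hj : ∃ i, g i = j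
      · obtain ⟨i, rfl⟩ := hj
        simp [hg.injective.extend_apply, ha]
      · simp [Function.extend_apply' _ _ _ hj]
    · by_cases hj : ∃ i, g i = j
      · obtain ⟨i, rfl⟩ := hj
        rw [hg.injective.extend_apply]
        intro x hx
        obtain ⟨y, hy, rfl⟩ := Finset.mem_map.mp hx
        exact (Finset.mem_attachFin _).mp (hS i hy)
      · simp [Function.extend_apply' _ _ _ hj]
  obtain ⟨Z, -, hZ, k, hk⟩ := htC (Fin tC) Finset.univ
    (fun G => if h : G.card = tA then colg (G.orderEmbOfFin h) else ⟨0, hr⟩) (by simp)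
  refine ⟨Z.orderEmbOfFin hZ, fun j => (Y (Z.orderEmbOfFin hZ j)).attachFin (hlt _), k tA,
    (Z.orderEmbOfFin hZ).strictMono, fun j => ?_, fun g' S hg' hS ha => ?_⟩
  · rw [Finset.card_attachFin, hYb]
  · have hg : StrictMono (Z.orderEmbOfFin hZ ∘ g') := (Z.orderEmbOfFin hZ).strictMono.comp hg'
    rw [hcolg _ S hg hS ha]
    have hcard : (Finset.univ.image (Z.orderEmbOfFin hZ ∘ g')).card = tA := by
      rw [Finset.card_image_of_injective _ hg.injective, Finset.card_univ, Fintype.card_fin]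
    have hkG := hk (Finset.univ.image (Z.orderEmbOfFin hZ ∘ g')) (by
      intro x hx
      obtain ⟨i, -, rfl⟩ := Finset.mem_image.mp hx
      exact Z.orderEmbOfFin_mem hZ _)
    rw [dif_pos hcard, hcard] at hkG
    rw [← hkG, ← Finset.orderEmbOfFin_unique hcard
      (fun i => Finset.mem_image_of_mem _ (Finset.mem_univ i)) hg]
end

section
/- Partite lemma for permutations: let a, r ≥ 1 be natural numbers, let A be the a-partite transversal determined by a permutation τ : Equiv.Perm (Fin a), and let B be an arbitrary a-partite permutation on n points. Then there exists an a-partite permutation C on some number of points such that for every coloring χ of the a-partite embeddings of A into C with r colors, there is an a-partite embedding g of B into C such that χ (g ∘ e) takes the same value for all a-partite embeddings e of A into B. -/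
/-- `(σ, π)` is an `a`-partite permutation on `n` points: the part map `π` is
monotone (so parts are consecutive intervals in the natural order), and the two
linear orders agree within each part. -/
def IsPartitePerm {a n : ℕ} (σ : Equiv.Perm (Fin n)) (π : Fin n → Fin a) : Prop :=
  Monotone π ∧ ∀ i j : Fin n, i < j → π i = π j → σ i < σ j

/-- An `a`-partite embedding of the `a`-partite permutation `(α, πA)` into
`(γ, πC)`: strictly monotone, part-preserving, and preserving/reflecting the
second linear order. -/
def PartiteEmbedding {a m n : ℕ} (α : Equiv.Perm (Fin m)) (πA : Fin m → Fin a)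
    (γ : Equiv.Perm (Fin n)) (πC : Fin n → Fin a) (f : Fin m → Fin n) : Prop :=
  StrictMono f ∧ (∀ i, πC (f i) = πA i) ∧ ∀ i j : Fin m, α i < α j ↔ γ (f i) < γ (f j)

/-- One extraction step towards Ramsey's theorem: if Ramsey's theorem holds for `k`-subsets, then
every large set has a subset on which the colour of a `(k + 1)`-subset depends only on its least
element. -/
theorem exists_subset_color_eq_of_min {κ : Type*} (k : ℕ)
    (ih : ∀ m : ℕ, ∃ M : ℕ, ∀ (α : Type) [LinearOrder α] (S : Finset α), M ≤ S.card →
      ∀ c : Finset α → κ, ∃ T ⊆ S, T.card = m ∧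
        ∃ col, ∀ U ⊆ T, U.card = k → c U = col) (m : ℕ) :
    ∃ M : ℕ, ∀ (α : Type) [LinearOrder α] (S : Finset α), M ≤ S.card →
      ∀ c : Finset α → κ, ∃ T ⊆ S, T.card = m ∧
        ∃ d : α → κ, ∀ x ∈ T, ∀ U ⊆ T, (∀ y ∈ U, x < y) → U.card = k →
          c (insert x U) = d x := by
  induction m with
  | zero =>
    refine ⟨0, fun α _ S _ c => ⟨∅, by simp, rfl, fun x => c {x}, by simp⟩⟩
  | succ m ihm =>
    obtain ⟨M', hM'⟩ := ihm
    obtain ⟨M, hM⟩ := ih M'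
    refine ⟨M + 1, fun α _ S hS c => ?_⟩
    have hne : S.Nonempty := Finset.card_pos.mp (by omega)
    set x := S.min' hne
    have hx : x ∈ S := S.min'_mem hne
    obtain ⟨T', hT'S, hT'c, col, hcol⟩ := hM α (S.erase x)
      (by rw [Finset.card_erase_of_mem hx]; omega) fun U => c (insert x U)
    obtain ⟨T, hTT', hTc, d, hd⟩ := hM' α T' hT'c.ge c
    have hlt : ∀ y ∈ T, x < y := fun y hy => S.min'_lt_of_mem_erase_min' hne (hT'S (hTT' hy))
    have hxT : x ∉ T := fun h => lt_irrefl x (hlt x h)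
    refine ⟨insert x T, ?_, by rw [Finset.card_insert_of_notMem hxT, hTc],
      Function.update d x col, ?_⟩
    · exact Finset.insert_subset hx ((hTT'.trans hT'S).trans (Finset.erase_subset _ _))
    · intro y hy U hU hyU hUc
      have hle : ∀ z ∈ insert x T, x ≤ z := by
        intro z hz
        rcases Finset.mem_insert.mp hz with rfl | hz
        · exact le_rfl
        · exact (hlt z hz).le
      have hUT : U ⊆ T := fun z hz => (Finset.mem_insert.mp (hU hz)).resolve_left
        fun h => absurd (hyU z hz) (not_lt.mpr (h ▸ hle y hy))
      rcases Finset.mem_insert.mp hy with rfl | hyT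
      · rw [Function.update_self]
        exact hcol U (hUT.trans hTT') hUc
      · rw [Function.update_of_ne (hlt y hyT).ne']
        exact hd y hyT U hUT hyU hUc

/-- The finite **Ramsey theorem** for colourings of `k`-subsets. -/
theorem exists_subset_color_eq {κ : Type*} [Finite κ] (k m : ℕ) :
    ∃ M : ℕ, ∀ (α : Type) [LinearOrder α] (S : Finset α), M ≤ S.card →
      ∀ c : Finset α → κ, ∃ T ⊆ S, T.card = m ∧
        ∃ col, ∀ U ⊆ T, U.card = k → c U = col := by
  classical
  induction k generalizing m with
  | zero =>
    refine ⟨m, fun α _ S hS c => ?_⟩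
    obtain ⟨T, hTS, hT⟩ := Finset.exists_subset_card_eq hS
    exact ⟨T, hTS, hT, c ∅, fun U _ hU => by rw [Finset.card_eq_zero.mp hU]⟩
  | succ k ih =>
    cases nonempty_fintype κ
    obtain ⟨M, hM⟩ := exists_subset_color_eq_of_min k ih (Fintype.card κ * m + 1)
    refine ⟨M, fun α _ S hS c => ?_⟩
    obtain ⟨T, hTS, hTc, d, hd⟩ := hM α S hS c
    obtain ⟨col, -, hcol⟩ := Finset.exists_lt_card_fiber_of_mul_lt_card_of_maps_to
      (s := T) (t := Finset.univ) (f := d) (n := m) (fun _ _ => Finset.mem_univ _)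
      (by rw [hTc, Finset.card_univ]; omega)
    obtain ⟨V, hVT, hV⟩ := Finset.exists_subset_card_eq hcol.le
    refine ⟨V, (hVT.trans (Finset.filter_subset _ _)).trans hTS, hV, col, fun U hU hUc => ?_⟩
    have hne : U.Nonempty := Finset.card_pos.mp (by omega)
    have hmem := U.min'_mem hne
    have hUT : U ⊆ T := (hU.trans hVT).trans (Finset.filter_subset _ _)
    rw [← Finset.insert_erase hmem, hd _ (hUT hmem) _ ((Finset.erase_subset _ _).trans hUT)
      (fun y hy => U.min'_lt_of_mem_erase_min' hne hy)
      (by rw [Finset.card_erase_of_mem hmem]; omega)]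
    exact (Finset.mem_filter.mp (hVT (hU hmem))).2

/-- The finite **Ramsey theorem** for colourings of increasing `k`-tuples. -/
theorem exists_orderEmbedding_color_eq (κ : Type*) [Finite κ] [Nonempty κ] (k m : ℕ) :
    ∃ M : ℕ, ∀ c : (Fin k ↪o Fin M) → κ, ∃ (h : Fin m ↪o Fin M) (col : κ),
      ∀ u : Fin k ↪o Fin m, c (u.trans h) = col := by
  classical
  obtain ⟨M, hM⟩ := exists_subset_color_eq (κ := κ) k m
  refine ⟨M, fun c => ?_⟩
  obtain ⟨T, -, hT, col, hcol⟩ := hM (Fin M) Finset.univ (by simp) fun U =>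
    if hU : U.card = k then c (U.orderEmbOfFin hU) else Classical.arbitrary κ
  refine ⟨T.orderEmbOfFin hT, col, fun u => ?_⟩
  set v : Fin k ↪o Fin M := u.trans (T.orderEmbOfFin hT)
  have hcard : (Finset.univ.map v.toEmbedding).card = k := by simp
  have hv : v = (Finset.univ.map v.toEmbedding).orderEmbOfFin hcard :=
    Finset.orderEmbOfFin_unique' hcard (by simp)
  have hsub : Finset.univ.map v.toEmbedding ⊆ T := by
    intro x hx
    obtain ⟨i, -, rfl⟩ := Finset.mem_map.mp hx
    exact T.orderEmbOfFin_mem hT (u i)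
  rw [hv, ← hcol _ hsub hcard, dif_pos hcard]

/-- `finProdFinEquiv` turns the lexicographic order on pairs into the natural order. -/
theorem finProdFinEquiv_lt_iff {m n : ℕ} (x y : Fin m × Fin n) :
    finProdFinEquiv x < finProdFinEquiv y ↔ x.1 < y.1 ∨ x.1 = y.1 ∧ x.2 < y.2 := by
  obtain ⟨⟨i, hi⟩, ⟨s, hs⟩⟩ := x
  obtain ⟨⟨j, hj⟩, ⟨t, ht⟩⟩ := y
  simp only [Fin.lt_def, Fin.ext_iff, finProdFinEquiv_apply_val]
  rcases lt_trichotomy i j with h | rfl | h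
  · have : n * (i + 1) ≤ n * j := Nat.mul_le_mul_left n h
    rw [mul_add] at this
    omega
  · omega
  · have : n * (j + 1) ≤ n * i := Nat.mul_le_mul_left n h
    rw [mul_add] at this
    omega

/-- Partite lemma for permutations: `A` is the `a`-partite transversal `(τ, id)`,
`B` is an arbitrary `a`-partite permutation on `n` points; then some `a`-partite
permutation `C` is Ramsey for `B` with respect to copies of `A` and `r` colours. -/
theorem partite_lemma (a r n : ℕ) (ha : 1 ≤ a) (hr : 1 ≤ r)
    (τ : Equiv.Perm (Fin a))
    (σB : Equiv.Perm (Fin n)) (πB : Fin n → Fin a) (hB : IsPartitePerm σB πB) :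
    ∃ (nc : ℕ) (σC : Equiv.Perm (Fin nc)) (πC : Fin nc → Fin a),
      IsPartitePerm σC πC ∧
      ∀ χ : (Fin a → Fin nc) → Fin r,
        ∃ g : Fin n → Fin nc,
          PartiteEmbedding σB πB σC πC g ∧
          ∃ k : Fin r, ∀ e : Fin a → Fin n,
            PartiteEmbedding τ (id : Fin a → Fin a) σB πB e → χ (g ∘ e) = k := by
  have : Nonempty (Fin r) := ⟨⟨0, hr⟩⟩
  obtain ⟨M, hM⟩ := exists_orderEmbedding_color_eq (Fin r) a n
  let σC : Equiv.Perm (Fin (a * M)) := finProdFinEquiv.symm.trans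
    ((Equiv.prodComm _ _).trans (finProdFinEquiv.trans (finCongr (Nat.mul_comm M a))))
  have hσC : ∀ x y : Fin a × Fin M, σC (finProdFinEquiv x) < σC (finProdFinEquiv y) ↔
      x.2 < y.2 ∨ x.2 = y.2 ∧ x.1 < y.1 := by
    intro x y
    rw [← Prod.fst_swap (p := x), ← Prod.fst_swap (p := y), ← Prod.snd_swap (p := x),
      ← Prod.snd_swap (p := y), ← finProdFinEquiv_lt_iff]
    simp [σC, Fin.lt_def]
  refine ⟨a * M, σC, fun x => (finProdFinEquiv.symm x).1, ⟨?_, ?_⟩, fun χ => ?_⟩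
  · intro x y hxy
    obtain ⟨x, rfl⟩ := finProdFinEquiv.surjective x
    obtain ⟨y, rfl⟩ := finProdFinEquiv.surjective y
    have := (finProdFinEquiv_lt_iff y x).not.mp hxy.not_gt
    simp only [Equiv.symm_apply_apply]
    exact not_lt.mp fun h => this (Or.inl h)
  · intro x y hxy hpart
    obtain ⟨x, rfl⟩ := finProdFinEquiv.surjective x
    obtain ⟨y, rfl⟩ := finProdFinEquiv.surjective y
    simp only [Equiv.symm_apply_apply] at hpart
    rw [finProdFinEquiv_lt_iff] at hxy
    rw [hσC]
    exact Or.inl (hxy.resolve_left hpart.not_lt).2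
  obtain ⟨h, col, hcol⟩ := hM fun u => χ fun i => finProdFinEquiv (i, u (τ i))
  refine ⟨fun b => finProdFinEquiv (πB b, h (σB b)), ⟨?_, ?_, ?_⟩, col, ?_⟩
  · intro i j hij
    rw [finProdFinEquiv_lt_iff]
    rcases (hB.1 hij.le).lt_or_eq with hlt | heq
    · exact Or.inl hlt
    · exact Or.inr ⟨heq, h.strictMono (hB.2 i j hij heq)⟩
  · simp
  · intro i j
    rw [hσC]
    simp only [h.lt_iff_lt, h.injective.eq_iff, σB.injective.eq_iff]
    refine ⟨Or.inl, fun hij => hij.resolve_right ?_⟩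
    rintro ⟨rfl, hlt⟩
    exact lt_irrefl _ hlt
  · rintro e ⟨-, he_part, he_order⟩
    let u : Fin a ↪o Fin n := OrderEmbedding.ofStrictMono (fun k => σB (e (τ.symm k)))
      fun k l hkl => (he_order _ _).mp (by simpa using hkl)
    rw [← hcol u]
    congr 1
    funext i
    simp only [Function.comp_apply, he_part, id_eq]
    change finProdFinEquiv (i, h (σB (e i))) =
      finProdFinEquiv (i, h (σB (e (τ.symm (τ i)))))
    rw [Equiv.symm_apply_apply]
end

section
/- Snake lemma: let a, r ≥ 1 be natural numbers, let A be the a-partite transversal determined by a permutation τ : Equiv.Perm (Fin a), and let B be the a-snake of length ξB ≥ 1. Then there exists a natural number ξC such that, with C the a-snake of length ξC, for every coloring χ of the a-partite embeddings of A into C with r colors, there is an a-partite embedding g of B into C such that χ (g ∘ e) takes the same value for all a-partite embeddings e of A into B. -/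
/-- The permutation of the `a`-snake of length `ξ`: the point in natural
position `i * ξ + x` (with `0 ≤ i < a`, `0 ≤ x < ξ`) is sent to second-order
rank `x * a + i`. -/
def snakePerm (a ξ : ℕ) : Equiv.Perm (Fin (a * ξ)) :=
  finProdFinEquiv.symm.trans ((Equiv.prodComm (Fin a) (Fin ξ)).trans
    (finProdFinEquiv.trans (finCongr (Nat.mul_comm ξ a))))

/-- The part map of the `a`-snake of length `ξ`: the point in natural position
`i * ξ + x` (with `0 ≤ i < a`, `0 ≤ x < ξ`) lies in part `i`. -/
def snakePart (a ξ : ℕ) : Fin (a * ξ) → Fin a :=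
  fun p => (finProdFinEquiv.symm p).1

/-- The finite Ramsey theorem for `k`-uniform hypergraphs: every colouring of the finite subsets of
a large enough finite set `S` in a linear order is constant on the `k`-subsets of some `H ⊆ S`
with `m` elements. -/
theorem exists_finset_monochromatic_powersetCard (r k m : ℕ) :
    ∃ N : ℕ, ∀ (α : Type) [LinearOrder α] (S : Finset α), N ≤ S.card →
      ∀ c : Finset α → Fin r, ∃ H ⊆ S, H.card = m ∧
        ∃ d : Fin r, ∀ s ⊆ H, s.card = k → c s = d := by
  induction k generalizing m with
  | zero =>
    refine ⟨m, fun α _ S hS c => ?_⟩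
    obtain ⟨H, hHS, hH⟩ := Finset.exists_subset_card_eq hS
    exact ⟨H, hHS, hH, c ∅, fun s _ hs => by rw [Finset.card_eq_zero.mp hs]⟩
  | succ k ih =>
    have endHomogeneous : ∀ n : ℕ, ∃ N : ℕ, ∀ (α : Type) [LinearOrder α] (S : Finset α),
        N ≤ S.card → ∀ c : Finset α → Fin r, ∃ H ⊆ S, H.card = n ∧
          ∃ d : α → Fin r, ∀ x ∈ H, ∀ s ⊆ H, (∀ y ∈ s, x < y) → s.card = k →
            c (insert x s) = d x := by
      intro n
      induction n with
      | zero =>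
        exact ⟨0, fun α _ S _ c => ⟨∅, Finset.empty_subset _, rfl, fun x => c {x}, by simp⟩⟩
      | succ n ihn =>
        obtain ⟨N, hN⟩ := ihn
        obtain ⟨M, hM⟩ := ih N
        refine ⟨M + 1, fun α _ S hS c => ?_⟩
        have hne : S.Nonempty := Finset.card_pos.mp (by omega)
        set x := S.min' hne
        have hxS : x ∈ S := S.min'_mem hne
        obtain ⟨T, hTS, hT, b, hb⟩ := hM α (S.erase x)
          (by rw [Finset.card_erase_of_mem hxS]; omega) (fun s => c (insert x s))
        obtain ⟨H, hHT, hH, d, hd⟩ := hN α T hT.ge c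
        have hlt : ∀ y ∈ H, x < y := fun y hy =>
          S.min'_lt_of_mem_erase_min' hne (hTS (hHT hy))
        have hxH : x ∉ H := fun h => lt_irrefl _ (hlt x h)
        refine ⟨insert x H, Finset.insert_subset hxS
          ((hHT.trans hTS).trans (Finset.erase_subset _ _)), by
          rw [Finset.card_insert_of_notMem hxH, hH], Function.update d x b, ?_⟩
        intro y hy s hs hys hsk
        have hxs : x ∉ s := fun h => by
          rcases Finset.mem_insert.mp hy with rfl | hy
          · exact lt_irrefl _ (hys _ h)
          · exact lt_asymm (hys _ h) (hlt y hy)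
        have hsH : s ⊆ H := (Finset.subset_insert_iff_of_notMem hxs).mp hs
        rcases Finset.mem_insert.mp hy with rfl | hy
        · rw [Function.update_self]
          exact hb s (hsH.trans hHT) hsk
        · rw [Function.update_of_ne (hlt y hy).ne']
          exact hd y hy s hsH hys hsk
    obtain ⟨N, hN⟩ := endHomogeneous (r * m + 1)
    refine ⟨N, fun α _ S hS c => ?_⟩
    obtain ⟨T, hTS, hT, d, hd⟩ := hN α S hS c
    obtain ⟨b, -, hb⟩ := Finset.exists_lt_card_fiber_of_mul_lt_card_of_maps_to
      (s := T) (t := (Finset.univ : Finset (Fin r))) (f := d) (n := m)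
      (fun _ _ => Finset.mem_univ _) (by simp [hT])
    obtain ⟨H, hHT, hH⟩ := Finset.exists_subset_card_eq hb.le
    refine ⟨H, (hHT.trans (Finset.filter_subset _ _)).trans hTS, hH, b, fun s hs hsk => ?_⟩
    have hne : s.Nonempty := Finset.card_pos.mp (by omega)
    have hmem := s.min'_mem hne
    have hx := Finset.mem_filter.mp (hHT (hs hmem))
    rw [← Finset.insert_erase hmem, ← hx.2]
    refine hd _ hx.1 _ ?_ (fun y hy => s.min'_lt_of_mem_erase_min' hne hy) (by
      rw [Finset.card_erase_of_mem hmem, hsk, Nat.add_sub_cancel])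
    exact fun y hy => (Finset.mem_filter.mp (hHT (hs (Finset.mem_of_mem_erase hy)))).1

theorem snakePerm_finProdFinEquiv_val {a ξ : ℕ} (i : Fin a) (x : Fin ξ) :
    (snakePerm a ξ (finProdFinEquiv (i, x)) : ℕ) = i + a * x := by
  simp [snakePerm]

theorem snakePart_finProdFinEquiv {a ξ : ℕ} (i : Fin a) (x : Fin ξ) :
    snakePart a ξ (finProdFinEquiv (i, x)) = i := by
  simp [snakePart]

theorem finProdFinEquiv_lt_of_lt_left {m n : ℕ} {i j : Fin m} (x y : Fin n) (h : i < j) :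
    finProdFinEquiv (i, x) < finProdFinEquiv (j, y) := by
  have h1 : n * ((i : ℕ) + 1) ≤ n * (j : ℕ) := Nat.mul_le_mul_left n h
  rw [Fin.lt_def, finProdFinEquiv_apply_val, finProdFinEquiv_apply_val]
  have := x.isLt
  dsimp only
  linarith

theorem finProdFinEquiv_lt_iff_right {m n : ℕ} (i : Fin m) {x y : Fin n} :
    finProdFinEquiv (i, x) < finProdFinEquiv (i, y) ↔ x < y := by
  rw [Fin.lt_def, finProdFinEquiv_apply_val, finProdFinEquiv_apply_val, Nat.add_lt_add_iff_right,
    Fin.lt_def]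

theorem snakePerm_lt_of_lt_right {a ξ : ℕ} (i j : Fin a) {x y : Fin ξ} (h : x < y) :
    snakePerm a ξ (finProdFinEquiv (i, x)) < snakePerm a ξ (finProdFinEquiv (j, y)) := by
  have h1 : a * ((x : ℕ) + 1) ≤ a * (y : ℕ) := Nat.mul_le_mul_left a h
  rw [Fin.lt_def, snakePerm_finProdFinEquiv_val, snakePerm_finProdFinEquiv_val]
  have := i.isLt
  linarith

/-- The map between snakes that keeps the part of each point and places it, inside that part,
according to the image of its second-order rank under `h`. -/
def snakeMap {a ξ η : ℕ} (h : Fin (a * ξ) → Fin η) (p : Fin (a * ξ)) : Fin (a * η) :=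
  finProdFinEquiv (snakePart a ξ p, h (snakePerm a ξ p))

theorem partiteEmbedding_snakeMap {a ξ η : ℕ} {h : Fin (a * ξ) → Fin η} (hh : StrictMono h) :
    PartiteEmbedding (snakePerm a ξ) (snakePart a ξ) (snakePerm a η) (snakePart a η)
      (snakeMap h) := by
  refine ⟨fun p q hpq => ?_, fun p => snakePart_finProdFinEquiv _ _, fun p q => ?_⟩
  · obtain ⟨⟨i, x⟩, rfl⟩ := finProdFinEquiv.surjective p
    obtain ⟨⟨j, y⟩, rfl⟩ := finProdFinEquiv.surjective q
    simp only [snakeMap, snakePart_finProdFinEquiv]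
    rcases lt_trichotomy i j with hij | rfl | hij
    · exact finProdFinEquiv_lt_of_lt_left _ _ hij
    · rw [finProdFinEquiv_lt_iff_right] at hpq ⊢
      exact hh (snakePerm_lt_of_lt_right _ _ hpq)
    · exact absurd hpq (finProdFinEquiv_lt_of_lt_left _ _ hij).asymm
  · have key : ∀ p q, snakePerm a ξ p < snakePerm a ξ q →
        snakePerm a η (snakeMap h p) < snakePerm a η (snakeMap h q) :=
      fun p q hpq => snakePerm_lt_of_lt_right _ _ (hh hpq)
    refine ⟨key p q, fun hpq => ?_⟩
    rcases lt_trichotomy (snakePerm a ξ p) (snakePerm a ξ q) with hlt | heq | hlt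
    · exact hlt
    · rw [(snakePerm a ξ).injective heq] at hpq
      exact absurd hpq (lt_irrefl _)
    · exact absurd hpq (key q p hlt).asymm

theorem orderEmbOfFin_image_univ_of_lt_iff_lt {a : ℕ} {α : Type*} [LinearOrder α]
    (τ : Equiv.Perm (Fin a)) {u : Fin a → α} (hu : ∀ i j, τ i < τ j ↔ u i < u j) :
    ∃ hs : (Finset.univ.image u).card = a,
      ∀ i, (Finset.univ.image u).orderEmbOfFin hs (τ i) = u i := by
  have mono : StrictMono (u ∘ τ.symm) := fun i j hij =>
    (hu _ _).mp (by simpa using hij)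
  have inj : Function.Injective u := by
    simpa [Function.comp_assoc] using mono.injective.comp τ.injective
  have hs : (Finset.univ.image u).card = a := by
    rw [Finset.card_image_of_injective _ inj, Finset.card_univ, Fintype.card_fin]
  refine ⟨hs, fun i => ?_⟩
  rw [← Finset.orderEmbOfFin_unique hs (fun x => by simp) mono]
  simp

/-- Snake lemma: `A` is the `a`-partite transversal `(τ, id)`, `B` is the
`a`-snake of length `ξB ≥ 1`; then some `a`-snake `C` (of length `ξC`) is
Ramsey for `B` with respect to copies of `A` and `r` colours. -/
theorem snake_lemma (a r ξB : ℕ) (ha : 1 ≤ a) (hr : 1 ≤ r) (hξB : 1 ≤ ξB)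
    (τ : Equiv.Perm (Fin a)) :
    ∃ ξC : ℕ,
      ∀ χ : (Fin a → Fin (a * ξC)) → Fin r,
        ∃ g : Fin (a * ξB) → Fin (a * ξC),
          PartiteEmbedding (snakePerm a ξB) (snakePart a ξB)
            (snakePerm a ξC) (snakePart a ξC) g ∧
          ∃ k : Fin r, ∀ e : Fin a → Fin (a * ξB),
            PartiteEmbedding τ (id : Fin a → Fin a) (snakePerm a ξB) (snakePart a ξB) e →
              χ (g ∘ e) = k := by
  obtain ⟨N, hN⟩ := exists_finset_monochromatic_powersetCard r a (a * ξB)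
  refine ⟨N, fun χ => ?_⟩
  obtain ⟨H, -, hH, k, hk⟩ := hN (Fin N) Finset.univ (by simp) fun s =>
    if hs : s.card = a then χ fun i => finProdFinEquiv (i, s.orderEmbOfFin hs (τ i))
    else ⟨0, hr⟩
  set h := H.orderEmbOfFin hH
  refine ⟨snakeMap h, partiteEmbedding_snakeMap h.strictMono, k, fun e he => ?_⟩
  obtain ⟨hs, hτ⟩ := orderEmbOfFin_image_univ_of_lt_iff_lt τ
    (u := fun i => h (snakePerm a ξB (e i))) fun i j => by
      rw [he.2.2 i j, h.lt_iff_lt]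
  rw [← hk _ (Finset.image_subset_iff.mpr fun i _ => H.orderEmbOfFin_mem hH _) hs, dif_pos hs]
  congr 1
  funext i
  rw [hτ, Function.comp_apply, snakeMap, he.2.1 i, id]
end

section
/- Amalgamation property for a-partite permutations: for every natural number a ≥ 1, for all a-partite permutations A, B, B' and all a-partite embeddings f of A into B and f' of A into B', there exist an a-partite permutation C and a-partite embeddings g of B into C and g' of B' into C such that g ∘ f = g' ∘ f'. -/
/-- A finite type with an injection into a linear order is enumerated increasingly by `Fin`. -/
theorem exists_equiv_fin_lt_iff {X L : Type*} [Finite X] [LinearOrder L] {u : X → L}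
    (hu : Function.Injective u) :
    ∃ e : X ≃ Fin (Nat.card X), ∀ x y, e x < e y ↔ u x < u y := by
  let : LinearOrder X := LinearOrder.lift' u hu
  let := Fintype.ofFinite X
  let e := (Fintype.orderIsoFinOfCardEq X (Nat.card_eq_fintype_card (α := X)).symm).symm
  exact ⟨e.toEquiv, fun x y => e.lt_iff_lt⟩

/-- A finite set `X` of colored points of a linear order `K` is an `a`-partite permutation into
which every `a`-partite permutation with a compatible map to `X` embeds. -/
theorem exists_partitePerm_of_finite {a : ℕ} {K : Type*} [LinearOrder K] (X : Set (Fin a × K))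
    (hX : X.Finite) :
    ∃ (n : ℕ) (σ : Equiv.Perm (Fin n)) (π : Fin n → Fin a) (e : X → Fin n),
      IsPartitePerm σ π ∧
      ∀ (m : ℕ) (τ : Equiv.Perm (Fin m)) (ρ : Fin m → Fin a) (k : Fin m → K)
        (hk : ∀ i, (ρ i, k i) ∈ X), IsPartitePerm τ ρ → (∀ i j, τ i < τ j ↔ k i < k j) →
        PartiteEmbedding τ ρ σ π fun i => e ⟨(ρ i, k i), hk i⟩ := by
  have : Finite X := hX
  obtain ⟨e₁, h₁⟩ := exists_equiv_fin_lt_iff (u := fun p : X => toLex p.1)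
    fun p q h => Subtype.ext (toLex.injective h)
  obtain ⟨e₂, h₂⟩ := exists_equiv_fin_lt_iff (u := fun p : X => toLex p.1.swap)
    fun p q h => Subtype.ext (Prod.swap_injective (toLex.injective h))
  refine ⟨Nat.card X, e₁.symm.trans e₂, fun i => (e₁.symm i).1.1, e₁, ⟨?_, ?_⟩, ?_⟩
  · intro i j hij
    obtain ⟨p, rfl⟩ := e₁.surjective i
    obtain ⟨q, rfl⟩ := e₁.surjective j
    rw [← not_lt, h₁, Prod.Lex.toLex_lt_toLex] at hij
    simp only [Equiv.symm_apply_apply]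
    by_contra! h
    exact hij (Or.inl h)
  · intro i j hij hc
    obtain ⟨p, rfl⟩ := e₁.surjective i
    obtain ⟨q, rfl⟩ := e₁.surjective j
    rw [h₁, Prod.Lex.toLex_lt_toLex] at hij
    simp only [Equiv.symm_apply_apply, Equiv.trans_apply] at hc ⊢
    rw [h₂, Prod.Lex.toLex_lt_toLex]
    exact Or.inl (hij.resolve_left hc.not_lt).2
  · intro m τ ρ k hk hτ hlt
    refine ⟨fun i j hij => ?_, fun i => congrArg (·.1.1) (e₁.symm_apply_apply _), fun i j => ?_⟩
    · rw [h₁, Prod.Lex.toLex_lt_toLex]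
      rcases (hτ.1 hij.le).lt_or_eq with h | h
      · exact Or.inl h
      · exact Or.inr ⟨h, (hlt i j).1 (hτ.2 i j hij h)⟩
    · simp only [Equiv.symm_apply_apply, Equiv.trans_apply]
      rw [h₂, Prod.Lex.toLex_lt_toLex, hlt]
      refine ⟨Or.inl, fun h => h.resolve_right ?_⟩
      rintro ⟨h, h'⟩
      have hne : i = j := by
        by_contra hij
        rcases lt_or_gt_of_ne (τ.injective.ne hij) with h | h <;>
          rw [hlt] at h <;> simp_all
      exact absurd h' (by simp [hne])

open Classical in
/-- The position of a point `b` in an amalgam over the image of `f`: first the number of points of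
the image of `f` that are at most `b`, then `0` for points of this image and `σ b + 1` for the
other points. -/
noncomputable def amalgamKey {m n : ℕ} (σ : Equiv.Perm (Fin n)) (f : Fin m → Fin n)
    (b : Fin n) : ℕ ×ₗ ℕ :=
  toLex ((Finset.univ.filter fun i => σ (f i) ≤ σ b).card,
    if b ∈ Set.range f then 0 else (σ b : ℕ) + 1)

theorem amalgamKey_lt {m n : ℕ} (σ : Equiv.Perm (Fin n)) (f : Fin m → Fin n)
    {b b' : Fin n} (h : σ b < σ b') : amalgamKey σ f b < amalgamKey σ f b' := by
  classical
  unfold amalgamKey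
  rw [Prod.Lex.toLex_lt_toLex]
  have hsub : (Finset.univ.filter fun i => σ (f i) ≤ σ b) ⊆
      Finset.univ.filter fun i => σ (f i) ≤ σ b' :=
    Finset.monotone_filter_right _ fun i _ hi => hi.trans h.le
  by_cases hb' : b' ∈ Set.range f
  · obtain ⟨i, rfl⟩ := hb'
    exact Or.inl (Finset.card_lt_card (Finset.ssubset_iff_of_subset hsub |>.2
      ⟨i, by simp, by simpa using h⟩))
  · rcases (Finset.card_le_card hsub).lt_or_eq with hlt | heq
    · exact Or.inl hlt
    · refine Or.inr ⟨heq, ?_⟩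
      have h' : (σ b : ℕ) < σ b' := h
      simp only [hb', if_false]
      split_ifs <;> omega

theorem amalgamKey_lt_iff {m n : ℕ} (σ : Equiv.Perm (Fin n)) (f : Fin m → Fin n)
    (b b' : Fin n) : σ b < σ b' ↔ amalgamKey σ f b < amalgamKey σ f b' := by
  refine ⟨amalgamKey_lt σ f, fun h => ?_⟩
  rcases lt_trichotomy (σ b) (σ b') with h' | h' | h'
  · exact h'
  · exact absurd h (by simp [σ.injective h'])
  · exact absurd h (amalgamKey_lt σ f h').not_gt

theorem amalgamKey_apply {a m n : ℕ} {α : Equiv.Perm (Fin m)} {πA : Fin m → Fin a}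
    {σ : Equiv.Perm (Fin n)} {π : Fin n → Fin a} {f : Fin m → Fin n}
    (hf : PartiteEmbedding α πA σ π f) (x : Fin m) :
    amalgamKey σ f (f x) = toLex ((Finset.univ.filter fun i => α i ≤ α x).card, 0) := by
  have h : ∀ i, σ (f i) ≤ σ (f x) ↔ α i ≤ α x := fun i => by
    rw [← not_lt, ← not_lt, hf.2.2]
  simp [amalgamKey, h]

/-- Amalgamation property for the class of `a`-partite permutations. -/
theorem partite_amalgamation (a : ℕ) (ha : 1 ≤ a) (nA nB nB' : ℕ)
    (σA : Equiv.Perm (Fin nA)) (πA : Fin nA → Fin a) (hA : IsPartitePerm σA πA)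
    (σB : Equiv.Perm (Fin nB)) (πB : Fin nB → Fin a) (hB : IsPartitePerm σB πB)
    (σB' : Equiv.Perm (Fin nB')) (πB' : Fin nB' → Fin a) (hB' : IsPartitePerm σB' πB')
    (f : Fin nA → Fin nB) (hf : PartiteEmbedding σA πA σB πB f)
    (f' : Fin nA → Fin nB') (hf' : PartiteEmbedding σA πA σB' πB' f') :
    ∃ (nC : ℕ) (σC : Equiv.Perm (Fin nC)) (πC : Fin nC → Fin a),
      IsPartitePerm σC πC ∧
      ∃ (g : Fin nB → Fin nC) (g' : Fin nB' → Fin nC),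
        PartiteEmbedding σB πB σC πC g ∧ PartiteEmbedding σB' πB' σC πC g' ∧
        g ∘ f = g' ∘ f' := by
  set k := amalgamKey σB f
  set k' := amalgamKey σB' f'
  obtain ⟨n, σ, π, e, hσ, he⟩ := exists_partitePerm_of_finite
    (Set.range (fun i => (πB i, k i)) ∪ Set.range fun i => (πB' i, k' i))
    ((Set.finite_range _).union (Set.finite_range _))
  refine ⟨n, σ, π, hσ, _, _,
    he nB σB πB k (fun i => Or.inl ⟨i, rfl⟩) hB (amalgamKey_lt_iff σB f),
    he nB' σB' πB' k' (fun i => Or.inr ⟨i, rfl⟩) hB' (amalgamKey_lt_iff σB' f'), ?_⟩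
  funext x
  simp only [Function.comp_apply]
  congr 2
  rw [Prod.mk.injEq, hf.2.1, hf'.2.1]
  exact ⟨rfl, (amalgamKey_apply hf x).trans (amalgamKey_apply hf' x).symm⟩
end

section
/- Ramsey theorem for structures with k linear orders: for every natural number k ≥ 1 and all natural numbers a, b, r ≥ 1, and for all families A : Fin k → Equiv.Perm (Fin a) and B : Fin k → Equiv.Perm (Fin b) encoding k linear orders on a-element and b-element sets respectively, there exist a natural number c and a family C : Fin k → Equiv.Perm (Fin c) such that for every coloring χ of the embeddings of A into C with r colors, there is an embedding g of B into C such that χ (g ∘ e) takes the same value for all embeddings e of A into B. -/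
/-- The induction step of the finite Ramsey theorem: if colourings of `a`-subsets have homogeneous
sets of every size, then every large finset has an `m`-subset in which the colour of an
`(a + 1)`-subset depends on its least element only. -/
theorem exists_card_forall_insert_eq {κ : Type*} (a : ℕ)
    (ih : ∀ m : ℕ, ∃ N : ℕ, ∀ (α : Type) [LinearOrder α] (χ : Finset α → κ) (S : Finset α),
      N ≤ S.card → ∃ T ⊆ S, T.card = m ∧ ∃ c, ∀ U ⊆ T, U.card = a → χ U = c) (m : ℕ) :
    ∃ N : ℕ, ∀ (α : Type) [LinearOrder α] (χ : Finset α → κ) (S : Finset α), N ≤ S.card →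
      ∃ T ⊆ S, T.card = m ∧ ∃ d : α → κ, ∀ x ∈ T, ∀ V ⊆ T, (∀ y ∈ V, x < y) → V.card = a →
        χ (insert x V) = d x := by
  induction m with
  | zero => exact ⟨0, fun α _ χ S _ => ⟨∅, by simp, rfl, fun _ => χ ∅, by simp⟩⟩
  | succ m hm =>
    obtain ⟨M, hM⟩ := hm
    obtain ⟨N, hN⟩ := ih M
    refine ⟨N + 1, fun α _ χ S hS => ?_⟩
    have hne : S.Nonempty := Finset.card_pos.1 (by omega)
    obtain ⟨T₁, hT₁, hcard₁, c, hc⟩ := hN α (fun V => χ (insert (S.min' hne) V))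
      (S.erase (S.min' hne)) (by rw [Finset.card_erase_of_mem (S.min'_mem hne)]; omega)
    obtain ⟨T, hT, hcard, d, hd⟩ := hM α χ T₁ hcard₁.ge
    have hlt : ∀ y ∈ T, S.min' hne < y := fun y hy =>
      S.min'_lt_of_mem_erase_min' hne (hT₁ (hT hy))
    have hnot : S.min' hne ∉ T := fun h => (hlt _ h).false
    refine ⟨insert (S.min' hne) T, ?_, by rw [Finset.card_insert_of_notMem hnot, hcard],
      Function.update d (S.min' hne) c, fun x hx V hV hxV hVa => ?_⟩
    · exact Finset.insert_subset (S.min'_mem hne)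
        ((hT.trans hT₁).trans (Finset.erase_subset _ _))
    have hmin : ∀ y ∈ insert (S.min' hne) T, S.min' hne ≤ y := by
      intro y hy
      rcases Finset.mem_insert.1 hy with rfl | hy
      exacts [le_rfl, (hlt y hy).le]
    have hVT : V ⊆ T := fun y hy => (Finset.mem_insert.1 (hV hy)).resolve_left
      ((hmin x hx).trans_lt (hxV y hy)).ne'
    rcases Finset.mem_insert.1 hx with rfl | hx
    · rw [Function.update_self]
      exact hc V (hVT.trans hT) hVa
    · rw [Function.update_of_ne (hlt x hx).ne']
      exact hd x hx V hVT hxV hVa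

/-- The finite Ramsey theorem for the `a`-subsets of a finset. -/
theorem finite_ramsey {κ : Type*} [Finite κ] (a m : ℕ) :
    ∃ N : ℕ, ∀ (α : Type) [LinearOrder α] (χ : Finset α → κ) (S : Finset α), N ≤ S.card →
      ∃ T ⊆ S, T.card = m ∧ ∃ c, ∀ U ⊆ T, U.card = a → χ U = c := by
  classical
  cases nonempty_fintype κ
  induction a generalizing m with
  | zero =>
    refine ⟨m, fun α _ χ S hS => ?_⟩
    obtain ⟨T, hT, hcard⟩ := Finset.exists_subset_card_eq hS
    refine ⟨T, hT, hcard, χ ∅, fun U _ hU => ?_⟩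
    rw [Finset.card_eq_zero.1 hU]
  | succ a ih =>
    obtain ⟨N, hN⟩ := exists_card_forall_insert_eq a ih (Fintype.card κ * m)
    refine ⟨N, fun α _ χ S hS => ?_⟩
    obtain ⟨T, hT, hcard, d, hd⟩ := hN α χ S hS
    have : Nonempty κ := ⟨χ ∅⟩
    obtain ⟨c, -, hc⟩ := Finset.exists_le_card_fiber_of_mul_le_card_of_maps_to
      (s := T) (t := Finset.univ) (f := d) (n := m) (by simp) Finset.univ_nonempty
      (by rw [hcard, Finset.card_univ])
    obtain ⟨T', hT', hcard'⟩ := Finset.exists_subset_card_eq hc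
    have hsub : T' ⊆ T := hT'.trans (Finset.filter_subset _ _)
    refine ⟨T', hsub.trans hT, hcard', c, fun U hU hUa => ?_⟩
    have hne : U.Nonempty := Finset.card_pos.1 (by omega)
    have hmem := U.min'_mem hne
    rw [← Finset.insert_erase hmem, hd _ (hsub (hU hmem)) _
      ((Finset.erase_subset _ _).trans (hU.trans hsub))
      (fun y hy => U.min'_lt_of_mem_erase_min' hne hy)
      (by rw [Finset.card_erase_of_mem hmem, hUa]; rfl)]
    exact (Finset.mem_filter.1 (hT' (hU hmem))).2

/-- The finite Ramsey theorem for linear orders, in terms of order embeddings. -/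
theorem finite_ramsey_orderEmbedding {κ : Type*} [Finite κ] [Nonempty κ] (a b : ℕ) :
    ∃ N : ℕ, ∀ χ : (Fin a ↪o Fin N) → κ, ∃ (G : Fin b ↪o Fin N) (c : κ),
      ∀ E : Fin a ↪o Fin b, χ (E.trans G) = c := by
  classical
  obtain ⟨N, hN⟩ := finite_ramsey (κ := κ) a b
  refine ⟨N, fun χ => ?_⟩
  obtain ⟨T, -, hcard, c, hc⟩ := hN (Fin N)
    (fun U => if h : U.card = a then χ (U.orderEmbOfFin h) else Classical.arbitrary κ)
    Finset.univ (by simp)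
  refine ⟨T.orderEmbOfFin hcard, c, fun E => ?_⟩
  have hU : (Finset.univ.map (E.trans (T.orderEmbOfFin hcard)).toEmbedding).card = a := by simp
  rw [← hc _ (fun x hx => ?_) hU, dif_pos hU]
  · congr 1
    exact Finset.orderEmbOfFin_unique' hU fun x => Finset.mem_map_of_mem _ (Finset.mem_univ x)
  · obtain ⟨i, -, rfl⟩ := Finset.mem_map.1 hx
    exact T.orderEmbOfFin_mem hcard _

/-- The product Ramsey theorem for finite linear orders. -/
theorem product_ramsey_orderEmbedding {κ : Type*} [Finite κ] [Nonempty κ] (k a b : ℕ) :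
    ∃ N : Fin k → ℕ, ∀ χ : (∀ s, Fin a ↪o Fin (N s)) → κ,
      ∃ (G : ∀ s, Fin b ↪o Fin (N s)) (c : κ),
        ∀ E : Fin k → (Fin a ↪o Fin b), χ (fun s => (E s).trans (G s)) = c := by
  induction k with
  | zero =>
    exact ⟨Fin.elim0, fun χ => ⟨fun s => s.elim0, χ fun s => s.elim0, fun E =>
      congrArg χ (Subsingleton.elim _ _)⟩⟩
  | succ k ih =>
    obtain ⟨N, hN⟩ := ih
    have (n : ℕ) : Finite (Fin a ↪o Fin n) := DFunLike.finite _
    obtain ⟨N₀, hN₀⟩ := finite_ramsey_orderEmbedding (κ := (∀ s, Fin a ↪o Fin (N s)) → κ) a b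
    refine ⟨Fin.cons N₀ N, fun χ => ?_⟩
    obtain ⟨G₀, χ', hχ'⟩ := hN₀ fun e₀ e =>
      χ (Fin.cons (α := fun s => Fin a ↪o Fin ((Fin.cons N₀ N : Fin (k + 1) → ℕ) s)) e₀ e)
    obtain ⟨G, c, hc⟩ := hN χ'
    refine ⟨Fin.cons (α := fun s => Fin b ↪o Fin ((Fin.cons N₀ N : Fin (k + 1) → ℕ) s)) G₀ G,
      c, fun E => ?_⟩
    rw [← hc fun s => E s.succ, ← hχ' (E 0)]
    refine congrArg χ (funext fun s => ?_)
    exact Fin.cases rfl (fun _ => rfl) s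

/-- Every function on `Fin c` is weakly sorted by some permutation. -/
theorem exists_perm_lt_of_lt {c : ℕ} {α : Type*} [LinearOrder α] (f : Fin c → α) :
    ∃ σ : Equiv.Perm (Fin c), ∀ i j, f i < f j → σ i < σ j := by
  refine ⟨(Tuple.sort f).symm, fun i j hij => lt_of_not_ge fun h => hij.not_ge ?_⟩
  simpa using Tuple.monotone_sort f h


/-- An embedding of the structure with `k` linear orders encoded by
`A : Fin k → Equiv.Perm (Fin a)` into the one encoded by
`C : Fin k → Equiv.Perm (Fin c)`: an injective map preserving and reflecting
each of the `k` linear orders. -/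
def MultiOrderEmbedding {k a c : ℕ} (A : Fin k → Equiv.Perm (Fin a))
    (C : Fin k → Equiv.Perm (Fin c)) (f : Fin a → Fin c) : Prop :=
  Function.Injective f ∧
    ∀ (s : Fin k) (i j : Fin a), A s i < A s j ↔ C s (f i) < C s (f j)

/-- Ramsey theorem for finite structures consisting of `k` linear orders. -/
theorem ramsey_k_linear_orders (k a b r : ℕ) (hk : 1 ≤ k) (ha : 1 ≤ a) (hb : 1 ≤ b)
    (hr : 1 ≤ r) (A : Fin k → Equiv.Perm (Fin a)) (B : Fin k → Equiv.Perm (Fin b)) :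
    ∃ (c : ℕ) (C : Fin k → Equiv.Perm (Fin c)),
      ∀ χ : (Fin a → Fin c) → Fin r,
        ∃ g : Fin b → Fin c, MultiOrderEmbedding B C g ∧
          ∃ k' : Fin r, ∀ e : Fin a → Fin b, MultiOrderEmbedding A B e → χ (g ∘ e) = k' := by
  have : Nonempty (Fin r) := ⟨⟨0, hr⟩⟩
  obtain ⟨N, hN⟩ := product_ramsey_orderEmbedding (κ := Fin r) k a b
  let idx := Fintype.equivFin (∀ s, Fin (N s))
  choose C hC using fun s => exists_perm_lt_of_lt fun x => idx.symm x s
  refine ⟨Fintype.card (∀ s, Fin (N s)), C, fun χ => ?_⟩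
  obtain ⟨G, k', hG⟩ := hN fun Y => χ fun i => idx fun s => Y s (A s i)
  refine ⟨fun i => idx fun s => G s (B s i), ⟨fun i j hij => ?_, fun s i j => ?_⟩,
    k', fun e he => ?_⟩
  · have h := congrFun (idx.injective hij) ⟨0, hk⟩
    exact (B _).injective ((G _).injective h)
  · have hlt : ∀ i j, B s i < B s j →
        C s (idx fun s => G s (B s i)) < C s (idx fun s => G s (B s j)) := fun i j hij =>
      hC s _ _ (by simpa using hij)
    refine ⟨hlt i j, fun h => lt_of_not_ge fun hji => ?_⟩
    rcases hji.eq_or_lt with heq | hji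
    · rw [(B s).injective heq] at h
      exact h.false
    · exact h.asymm (hlt j i hji)
  · have hmono (s : Fin k) : StrictMono fun t => B s (e ((A s).symm t)) := fun t u htu =>
      (he.2 s _ _).1 (by simpa using htu)
    rw [← hG fun s => OrderEmbedding.ofStrictMono _ (hmono s)]
    congr 1
    funext i
    simp
end
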